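/- Let I = (n_1, …, n_l) be a composition of n and G_i ≤ GL_{n_i}(F_q). For each 1 ≤ i ≤ l, let P_i = F_q[x_{m_{i−1}+1}, …, x_{m_i}] with G_i acting on these n_i variables via GL_{n_i}(F_q), and suppose the set of all monomial factors of x_{m_{i−1}+1}^{α_{i,1}} ⋯ x_{m_i}^{α_{i,n_i}} is a basis of P_i as a module over P_i^{G_i}. Then the monomial Π_{i=1}^l Π_{j=1}^{n_i} x_{m_{i−1}+j}^{(α_{i,j}+1)·q^{m_{i−1}} − 1} generates a block basis for the coinvariant algebra P_{G_I}: the set of all its monomial factors projects to an F_q-basis of P/I_{G_I}. -/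

import Mathlib

open MvPolynomial Finset

/-- The action of a matrix `g` on `F_q[x_1, …, x_n]`: the algebra map sending
`x_j` to `Σ_i g_{ij} x_i`. -/
noncomputable def matAct {K : Type*} [Field K] {n : ℕ} (g : Matrix (Fin n) (Fin n) K) :
    MvPolynomial (Fin n) K →ₐ[K] MvPolynomial (Fin n) K :=
  aeval fun j => ∑ i, C (g i j) * X i

/-- The subalgebra of polynomials invariant under every matrix in `G`. -/
noncomputable def invariants {K : Type*} [Field K] {n : ℕ} (G : Set (GL (Fin n) K)) :
    Subalgebra K (MvPolynomial (Fin n) K) where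
  carrier := {f | ∀ g ∈ G, matAct ((g : GL (Fin n) K) : Matrix (Fin n) (Fin n) K) f = f}
  mul_mem' := by
    intro a b ha hb g hg
    rw [map_mul, ha g hg, hb g hg]
  add_mem' := by
    intro a b ha hb g hg
    rw [map_add, ha g hg, hb g hg]
  algebraMap_mem' := by
    intro c g hg
    simp [matAct]

/-- The ideal generated by the homogeneous `G`-invariants of positive degree;
the quotient by it is the algebra of coinvariants. -/
noncomputable def coinvIdeal {K : Type*} [Field K] {n : ℕ} (G : Set (GL (Fin n) K)) :
    Ideal (MvPolynomial (Fin n) K) :=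
  Ideal.span {f | f ∈ invariants G ∧ ∃ d, 0 < d ∧ f.IsHomogeneous d}

/-- `tauf m s` is the largest partial sum `m i` which is `≤ s`; for `s` in the
`(j+1)`-st block this is `m j`. -/
def tauf {l : ℕ} (m : Fin (l + 1) → ℕ) (s : ℕ) : ℕ :=
  ((Finset.univ : Finset (Fin (l + 1))).filter fun i => m i ≤ s).sup m

/-- `U_I`: block upper triangular matrices whose diagonal blocks are identity
matrices (blocks determined by the partial sums `m`). -/
def USet (K : Type*) [Field K] {l : ℕ} (n : ℕ) (m : Fin (l + 1) → ℕ) :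
    Set (GL (Fin n) K) :=
  {g | ∀ s t : Fin n, tauf m (t : ℕ) ≤ tauf m (s : ℕ) →
    (g : Matrix (Fin n) (Fin n) K) s t = if s = t then 1 else 0}

/-- The global index of the `j`-th variable of the `i`-th block. -/
def emb {l : ℕ} (n : ℕ) (m : Fin (l + 1) → ℕ) (hmono : StrictMono m)
    (hlast : m (Fin.last l) = n) (i : Fin l)
    (j : Fin (m i.succ - m i.castSucc)) : Fin n :=
  ⟨m i.castSucc + (j : ℕ), by
    have h1 : m i.succ ≤ n := hlast ▸ hmono.monotone (Fin.le_last _)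
    have h2 := j.2
    omega⟩

/-- `G_I`: block upper triangular matrices whose `i`-th diagonal block lies in
`G i` (and whose entries above the diagonal blocks are arbitrary). -/
def GSet (K : Type*) [Field K] {l : ℕ} (n : ℕ) (m : Fin (l + 1) → ℕ)
    (hmono : StrictMono m) (hlast : m (Fin.last l) = n)
    (G : (i : Fin l) → Subgroup (GL (Fin (m i.succ - m i.castSucc)) K)) :
    Set (GL (Fin n) K) :=
  {g | (∀ s t : Fin n, tauf m (t : ℕ) < tauf m (s : ℕ) →
          (g : Matrix (Fin n) (Fin n) K) s t = 0) ∧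
    ∀ i : Fin l, ∃ h ∈ G i, ∀ j k : Fin (m i.succ - m i.castSucc),
      (g : Matrix (Fin n) (Fin n) K) (emb n m hmono hlast i j) (emb n m hmono hlast i k) =
        (h : Matrix (Fin (m i.succ - m i.castSucc)) (Fin (m i.succ - m i.castSucc)) K) j k}

/-- `Fpoly K k hk t = Π_{(λ_1,…,λ_k) ∈ K^k} (t + λ_1 x_1 + ⋯ + λ_k x_k)`. -/
noncomputable def Fpoly (K : Type*) [Field K] [Fintype K] {n : ℕ} (k : ℕ) (hk : k ≤ n)
    (t : MvPolynomial (Fin n) K) : MvPolynomial (Fin n) K :=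
  ∏ c : Fin k → K, (t + ∑ i : Fin k, C (c i) * X (Fin.castLE hk i))

/-- `v_{i,j} = F_{m_{i-1}}(x_{m_{i-1}+j})`. -/
noncomputable def vij (K : Type*) [Field K] [Fintype K] {l : ℕ} (n : ℕ)
    (m : Fin (l + 1) → ℕ) (hmono : StrictMono m) (hlast : m (Fin.last l) = n)
    (i : Fin l) (j : Fin (m i.succ - m i.castSucc)) : MvPolynomial (Fin n) K :=
  Fpoly K (m i.castSucc)
    (le_trans (hmono.monotone (Fin.le_last _)) (le_of_eq hlast))
    (X (emb n m hmono hlast i j))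

section MatrixAction

variable {K : Type*} [Field K] {n : ℕ}

lemma matAct_X (g : Matrix (Fin n) (Fin n) K) (j : Fin n) :
    matAct g (X j) = ∑ i, C (g i j) * X i := by
  simp [matAct]

lemma matAct_one : matAct (1 : Matrix (Fin n) (Fin n) K) = AlgHom.id K _ := by
  refine MvPolynomial.algHom_ext fun j => ?_
  rw [matAct_X, Finset.sum_eq_single j] <;> simp +contextual

lemma matAct_mul_apply (g h : Matrix (Fin n) (Fin n) K) (f : MvPolynomial (Fin n) K) :
    matAct (g * h) f = matAct g (matAct h f) := by
  suffices matAct (g * h) = (matAct g).comp (matAct h) by rw [this, AlgHom.comp_apply]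
  refine MvPolynomial.algHom_ext fun j => ?_
  simp only [AlgHom.comp_apply, matAct_X, map_sum, map_mul, Matrix.mul_apply, algHom_C,
    algebraMap_eq, Finset.sum_mul, Finset.mul_sum]
  rw [Finset.sum_comm]
  exact Finset.sum_congr rfl fun i _ => Finset.sum_congr rfl fun k _ => by ring

lemma matAct_GL_injective (g : GL (Fin n) K) :
    Function.Injective (matAct (g : Matrix (Fin n) (Fin n) K)) := by
  refine Function.LeftInverse.injective
    (g := matAct ((g⁻¹ : GL (Fin n) K) : Matrix (Fin n) (Fin n) K)) fun f => ?_
  rw [← matAct_mul_apply, ← Units.val_mul, inv_mul_cancel, Units.val_one, matAct_one,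
    AlgHom.id_apply]

lemma matAct_injective :
    Function.Injective (matAct : Matrix (Fin n) (Fin n) K → _) := by
  intro g h hgh
  ext i j
  have := congrArg (coeff (Finsupp.single i 1)) (DFunLike.congr_fun hgh (X j))
  simpa [matAct_X, coeff_sum, coeff_C_mul, coeff_X, Finsupp.single_left_inj] using this

lemma IsHomogeneous.matAct (g : Matrix (Fin n) (Fin n) K) {f : MvPolynomial (Fin n) K} {d : ℕ}
    (hf : f.IsHomogeneous d) : (matAct g f).IsHomogeneous d := by
  have := hf.aeval (n := 1) (fun j => ∑ i, C (g i j) * X i) fun j =>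
    IsHomogeneous.sum _ _ _ fun i _ => isHomogeneous_C_mul_X _ _
  rwa [one_mul] at this

lemma homogeneousComponent_matAct (g : Matrix (Fin n) (Fin n) K) (f : MvPolynomial (Fin n) K)
    (d : ℕ) :
    homogeneousComponent d (matAct g f) = matAct g (homogeneousComponent d f) := by
  conv_lhs => rw [← sum_homogeneousComponent f]
  rw [map_sum, map_sum]
  have key (i : ℕ) : homogeneousComponent d (matAct g (homogeneousComponent i f)) =
      if d = i then matAct g (homogeneousComponent d f) else 0 := by
    rw [homogeneousComponent_of_mem
      (IsHomogeneous.matAct g (homogeneousComponent_isHomogeneous i f))]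
    split_ifs with h
    · rw [h]
    · rfl
  simp only [key, Finset.sum_ite_eq, Finset.mem_range]
  split_ifs with h
  · rfl
  · rw [homogeneousComponent_eq_zero d f (by omega), map_zero]

lemma homogeneousComponent_mem_invariants {G : Set (GL (Fin n) K)} {f : MvPolynomial (Fin n) K}
    (hf : f ∈ invariants G) (d : ℕ) : homogeneousComponent d f ∈ invariants G := fun g hg => by
  rw [← homogeneousComponent_matAct, hf g hg]

lemma matAct_smul_invariants {G : Set (GL (Fin n) K)} {g : GL (Fin n) K} (hg : g ∈ G)
    (a : invariants G) (f : MvPolynomial (Fin n) K) :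
    matAct (g : Matrix (Fin n) (Fin n) K) (a • f) = a • matAct (g : Matrix (Fin n) (Fin n) K) f := by
  rw [Algebra.smul_def, map_mul, Algebra.smul_def]
  exact congrArg (· * _) (a.2 g hg)

/-- Dedekind's independence of characters for the linear action. -/
lemma linearIndependent_matAct :
    LinearIndependent (MvPolynomial (Fin n) K)
      (fun (g : GL (Fin n) K) (f : MvPolynomial (Fin n) K) =>
        matAct (g : Matrix (Fin n) (Fin n) K) f) := by
  let φ (g : GL (Fin n) K) : MvPolynomial (Fin n) K →* MvPolynomial (Fin n) K :=
    (matAct (g : Matrix (Fin n) (Fin n) K)).toRingHom.toMonoidHom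
  have hφ : Function.Injective φ := fun g h hgh =>
    Units.ext (matAct_injective (AlgHom.ext fun f => DFunLike.congr_fun hgh f))
  exact (linearIndependent_monoidHom (MvPolynomial (Fin n) K) (MvPolynomial (Fin n) K)).comp φ hφ

lemma card_le_of_span_invariants_eq_top {ι : Type*} [Fintype ι] (G : Set (GL (Fin n) K))
    [Fintype G] (e : ι → MvPolynomial (Fin n) K)
    (he : Submodule.span (invariants G) (Set.range e) = ⊤) :
    Fintype.card G ≤ Fintype.card ι := by
  let T : (G → MvPolynomial (Fin n) K) →ₗ[MvPolynomial (Fin n) K] (ι → MvPolynomial (Fin n) K) :=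
    LinearMap.pi fun i => ∑ g : G,
      (LinearMap.proj g).smulRight (matAct ((g : GL (Fin n) K) : Matrix (Fin n) (Fin n) K) (e i))
  refine card_le_of_injective (R := MvPolynomial (Fin n) K) T
    ((injective_iff_map_eq_zero T).2 fun a ha => ?_)
  have hT (i : ι) : ∑ g : G, a g * matAct ((g : GL (Fin n) K) : Matrix (Fin n) (Fin n) K) (e i)
      = 0 := by
    simpa [T] using congrFun ha i
  have hall (f : MvPolynomial (Fin n) K) :
      ∑ g : G, a g * matAct ((g : GL (Fin n) K) : Matrix (Fin n) (Fin n) K) f = 0 := by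
    have hf : f ∈ Submodule.span (invariants G) (Set.range e) := by
      rw [he]
      exact Submodule.mem_top
    induction hf using Submodule.span_induction with
    | mem x hx => obtain ⟨i, rfl⟩ := hx; exact hT i
    | zero => simp
    | add x y _ _ hx hy => simp only [map_add, mul_add, Finset.sum_add_distrib, hx, hy, add_zero]
    | smul c x _ hx =>
      have hc (g : G) : a g * matAct ((g : GL (Fin n) K) : Matrix (Fin n) (Fin n) K) (c • x) =
          c.1 * (a g * matAct ((g : GL (Fin n) K) : Matrix (Fin n) (Fin n) K) x) := by
        rw [matAct_smul_invariants g.2, Algebra.smul_def]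
        exact mul_left_comm _ _ _
      simp only [hc, ← Finset.mul_sum, hx, mul_zero]
  have hli := linearIndependent_matAct.comp (fun g : G => (g : GL (Fin n) K))
    Subtype.val_injective
  rw [Fintype.linearIndependent_iff] at hli
  funext g
  exact hli a (funext fun f => by simpa using hall f) g

lemma card_le_of_linearIndependent_invariants {ι : Type*} [Fintype ι]
    (G : Subgroup (GL (Fin n) K)) [Fintype G] (e : ι → MvPolynomial (Fin n) K)
    (he : LinearIndependent (invariants (G : Set (GL (Fin n) K))) e) :
    Fintype.card ι ≤ Fintype.card G := by
  let T : (ι → MvPolynomial (Fin n) K) →ₗ[MvPolynomial (Fin n) K] (G → MvPolynomial (Fin n) K) :=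
    LinearMap.pi fun g => ∑ i : ι,
      (LinearMap.proj i).smulRight (matAct ((g : GL (Fin n) K) : Matrix (Fin n) (Fin n) K) (e i))
  refine card_le_of_injective (R := MvPolynomial (Fin n) K) T
    ((injective_iff_map_eq_zero T).2 fun a ha => ?_)
  have hT (g : G) : ∑ i, a i * matAct ((g : GL (Fin n) K) : Matrix (Fin n) (Fin n) K) (e i)
      = 0 := by
    simpa [T] using congrFun ha g
  let tr (f : MvPolynomial (Fin n) K) : MvPolynomial (Fin n) K :=
    ∑ h : G, matAct ((h : GL (Fin n) K) : Matrix (Fin n) (Fin n) K) f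
  have htr (f) : tr f ∈ invariants (G : Set (GL (Fin n) K)) := fun g hg => by
    simp only [tr, map_sum, ← matAct_mul_apply, ← Units.val_mul]
    exact Fintype.sum_equiv (Equiv.mulLeft (⟨g, hg⟩ : G)) _ _ fun h => rfl
  have hzero (c : MvPolynomial (Fin n) K) (i : ι) : tr (c * a i) = 0 := by
    rw [Fintype.linearIndependent_iff] at he
    refine congrArg Subtype.val (he (fun i => ⟨tr (c * a i), htr _⟩) ?_ i)
    change ∑ i, tr (c * a i) * e i = 0
    simp only [tr, Finset.sum_mul]
    rw [Finset.sum_comm]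
    refine Finset.sum_eq_zero fun h _ => ?_
    have := congrArg (matAct ((h : GL (Fin n) K) : Matrix (Fin n) (Fin n) K)) (hT h⁻¹)
    simp only [map_sum, map_mul, map_zero, ← matAct_mul_apply] at this
    simp only [InvMemClass.coe_inv, ← Units.val_mul, mul_inv_cancel, Units.val_one, matAct_one,
      AlgHom.id_apply] at this
    simp only [map_mul, mul_assoc, ← Finset.mul_sum, this, mul_zero]
  have hli := linearIndependent_matAct.comp (fun g : G => (g : GL (Fin n) K))
    Subtype.val_injective
  rw [Fintype.linearIndependent_iff] at hli
  funext i
  have := hli (fun h => matAct ((h : GL (Fin n) K) : Matrix (Fin n) (Fin n) K) (a i))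
    (funext fun f => by simpa [tr, mul_comm] using hzero f i) 1
  simpa [matAct_one] using this

lemma homogeneousComponent_mul_of_isHomogeneous (a : MvPolynomial (Fin n) K)
    {g : MvPolynomial (Fin n) K} {e : ℕ} (hg : g.IsHomogeneous e) (d : ℕ) :
    homogeneousComponent d (a * g) =
      if e ≤ d then homogeneousComponent (d - e) a * g else 0 := by
  let := gradedAlgebra (σ := Fin n) (R := K)
  have h (x : MvPolynomial (Fin n) K) (i : ℕ) :
      (DirectSum.decompose (homogeneousSubmodule (Fin n) K) x i : MvPolynomial (Fin n) K) =
        homogeneousComponent i x := decomposition.decompose'_apply x i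
  rw [← h, ← h, DirectSum.coe_decompose_mul_of_right_mem _ d hg]

lemma homogeneousComponent_mem_coinvIdeal {G : Set (GL (Fin n) K)} {f : MvPolynomial (Fin n) K}
    (hf : f ∈ coinvIdeal G) (d : ℕ) : homogeneousComponent d f ∈ coinvIdeal G :=
  let := gradedAlgebra (σ := Fin n) (R := K)
  homogeneousComponent_mem_of_mem
    (Ideal.homogeneous_span _ _ fun _ hg => ⟨hg.2.choose, hg.2.choose_spec.2⟩) hf d

lemma sub_C_mem_coinvIdeal {G : Set (GL (Fin n) K)} {f : MvPolynomial (Fin n) K}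
    (hf : f ∈ invariants G) : f - C (coeff 0 f) ∈ coinvIdeal G := by
  have h := sum_homogeneousComponent f
  rw [Finset.sum_range_succ', homogeneousComponent_zero] at h
  rw [← eq_sub_iff_add_eq.2 h]
  exact Ideal.sum_mem _ fun i _ => Ideal.subset_span
    ⟨homogeneousComponent_mem_invariants hf _, i + 1, i.succ_pos,
      homogeneousComponent_isHomogeneous _ _⟩

/-- Graded Nakayama: homogeneous polynomials spanning the coinvariants generate the polynomial
ring over the invariants. -/
lemma span_invariants_eq_top {ι : Type*} (G : Set (GL (Fin n) K))
    (e : ι → MvPolynomial (Fin n) K) (he : ∀ i, ∃ d, (e i).IsHomogeneous d)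
    (hspan : ∀ f : MvPolynomial (Fin n) K, ∃ y ∈ Submodule.span K (Set.range e),
      f - y ∈ coinvIdeal G) :
    Submodule.span (invariants G) (Set.range e) = ⊤ := by
  set M := Submodule.span (invariants G) (Set.range e)
  have hK (y) (hy : y ∈ Submodule.span K (Set.range e)) (d : ℕ) :
      homogeneousComponent d y ∈ M := by
    induction hy using Submodule.span_induction with
    | mem x hx =>
      obtain ⟨i, rfl⟩ := hx
      obtain ⟨k, hk⟩ := he i
      rw [homogeneousComponent_of_mem hk]
      split_ifs
      · exact Submodule.subset_span ⟨i, rfl⟩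
      · exact M.zero_mem
    | zero => rw [map_zero]; exact M.zero_mem
    | add x y _ _ hx hy => rw [map_add]; exact M.add_mem hx hy
    | smul c x _ hx =>
      rw [map_smul, ← algebraMap_smul (invariants G) c]
      exact M.smul_mem _ hx
  have key (d : ℕ) : ∀ f : MvPolynomial (Fin n) K, homogeneousComponent d f ∈ M := by
    induction d using Nat.strong_induction_on with
    | _ d ih =>
      intro f
      obtain ⟨y, hy, hfy⟩ := hspan f
      rw [← sub_add_cancel f y, map_add]
      refine M.add_mem ?_ (hK y hy d)
      suffices ∀ a, homogeneousComponent d (a * (f - y)) ∈ M by simpa using this 1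
      refine Submodule.span_induction (p := fun z _ => ∀ a, homogeneousComponent d (a * z) ∈ M)
        ?_ ?_ ?_ ?_ hfy
      · rintro g ⟨hg, k, hk, hgk⟩ a
        rw [homogeneousComponent_mul_of_isHomogeneous a hgk]
        split_ifs
        · rw [mul_comm]
          exact M.smul_mem ⟨g, hg⟩ (ih _ (by omega) a)
        · exact M.zero_mem
      · intro a
        rw [mul_zero, map_zero]
        exact M.zero_mem
      · intro x y _ _ hx hy a
        rw [mul_add, map_add]
        exact M.add_mem (hx a) (hy a)
      · intro b x _ hx a
        rw [smul_eq_mul, ← mul_assoc]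
        exact hx _
  refine eq_top_iff.2 fun f _ => ?_
  rw [← sum_homogeneousComponent f]
  exact M.sum_mem fun i _ => key i f

end MatrixAction

section Triangular

variable {K P : Type*} [Field K] [CommRing P] [Algebra K P]

/-- The span over `R` of the monomials in `x` of total degree less than `d`. -/
def degreeLTSpan (R : Subalgebra K P) {ι : Type*} [Fintype ι] (x : ι → P) (d : ℕ) :
    Submodule R P :=
  Submodule.span R ((fun B : ι → ℕ => ∏ j, x j ^ B j) '' {B | ∑ j, B j < d})

/-- `f` and `g` have degree at most `d` in `x` over `R` and agree in degree `d`. -/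
def AgreesInDegree (R : Subalgebra K P) {ι : Type*} [Fintype ι] (x : ι → P) (d : ℕ)
    (f g : P) : Prop :=
  f ∈ degreeLTSpan R x (d + 1) ∧ g ∈ degreeLTSpan R x (d + 1) ∧ f - g ∈ degreeLTSpan R x d

section OneBlock

variable {R : Subalgebra K P} {ι : Type*} [Fintype ι] {x : ι → P}

lemma mul_mem_degreeLTSpan {d e : ℕ} {f g : P} (hf : f ∈ degreeLTSpan R x (d + 1))
    (hg : g ∈ degreeLTSpan R x e) : f * g ∈ degreeLTSpan R x (d + e) := by
  have h := Submodule.mul_mem_mul hf hg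
  rw [degreeLTSpan, degreeLTSpan, Submodule.span_mul_span] at h
  refine Submodule.span_mono ?_ h
  rintro _ ⟨_, ⟨B, hB, rfl⟩, _, ⟨B', hB', rfl⟩, rfl⟩
  refine ⟨B + B', ?_, ?_⟩
  · simp only [Set.mem_ofPred_eq, Pi.add_apply, Finset.sum_add_distrib] at hB hB' ⊢
    omega
  · simp only [Pi.add_apply, pow_add, Finset.prod_mul_distrib]

lemma AgreesInDegree.mul {d e : ℕ} {f g f' g' : P} (h : AgreesInDegree R x d f g)
    (h' : AgreesInDegree R x e f' g') : AgreesInDegree R x (d + e) (f * f') (g * g') := by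
  refine ⟨mul_mem_degreeLTSpan (e := e + 1) h.1 h'.1,
    mul_mem_degreeLTSpan (e := e + 1) h.2.1 h'.2.1, ?_⟩
  have h1 := mul_mem_degreeLTSpan h.1 h'.2.2
  have h2 := mul_mem_degreeLTSpan h'.2.1 h.2.2
  rw [add_comm e d] at h2
  convert add_mem h1 h2 using 1
  ring

lemma AgreesInDegree.one : AgreesInDegree R x 0 1 1 := by
  have : (1 : P) ∈ degreeLTSpan R x (0 + 1) := Submodule.subset_span ⟨0, by simp, by simp⟩
  exact ⟨this, this, by simp⟩

lemma AgreesInDegree.prod {κ : Type*} (s : Finset κ) {d : κ → ℕ} {f g : κ → P}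
    (h : ∀ c ∈ s, AgreesInDegree R x (d c) (f c) (g c)) :
    AgreesInDegree R x (∑ c ∈ s, d c) (∏ c ∈ s, f c) (∏ c ∈ s, g c) := by
  classical
  induction s using Finset.induction_on with
  | empty => exact AgreesInDegree.one
  | insert a s ha ih =>
    rw [Finset.sum_insert ha, Finset.prod_insert ha, Finset.prod_insert ha]
    exact (h a (by simp)).mul (ih fun c hc => h c (by simp [hc]))

lemma AgreesInDegree.pow {d : ℕ} {f g : P} (h : AgreesInDegree R x d f g) (k : ℕ) :
    AgreesInDegree R x (k * d) (f ^ k) (g ^ k) := by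
  simpa using AgreesInDegree.prod (Finset.range k) fun _ _ => h

lemma AgreesInDegree.add_right {u : P} (hu : u ∈ R) (j : ι) :
    AgreesInDegree R x 1 (x j + u) (x j) := by
  classical
  have h1 : (1 : P) ∈ degreeLTSpan R x 1 := AgreesInDegree.one.1
  have hu1 : u ∈ degreeLTSpan R x 1 := by
    have := (degreeLTSpan R x 1).smul_mem ⟨u, hu⟩ h1
    rwa [Algebra.smul_def, mul_one] at this
  have hmono : degreeLTSpan R x 1 ≤ degreeLTSpan R x (1 + 1) :=
    Submodule.span_mono (Set.image_mono fun B (hB : ∑ j, B j < 1) => hB.trans (by omega))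
  have hx : x j ∈ degreeLTSpan R x (1 + 1) :=
    Submodule.subset_span ⟨Pi.single j 1, by simp, by
      simp only
      rw [Finset.prod_eq_single j]
      · simp
      · intro i _ hi
        simp [hi]
      · simp⟩
  exact ⟨add_mem hx (hmono hu1), hx, by simpa using hu1⟩

lemma prod_pow_mem_span_sup {Q : ℕ} (hQ : 0 < Q) {J : Ideal P} {v : ι → P}
    (hv : ∀ j, AgreesInDegree R x Q (v j) (x j ^ Q)) {α : ι → ℕ}
    (hred : ∀ c : ι → ℕ, ∃ y ∈ Submodule.span K ((fun c' : ι → ℕ => ∏ j, v j ^ c' j) ''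
      {c' | (∀ j, c' j ≤ α j) ∧ ∑ j, c' j = ∑ j, c j}), ∏ j, v j ^ c j - y ∈ J)
    (B : ι → ℕ) :
    ∏ j, x j ^ B j ∈ Submodule.span R ((fun b : ι → ℕ => ∏ j, x j ^ b j) ''
      {b | ∀ j, b j ≤ (α j + 1) * Q - 1}) ⊔ J.restrictScalars R := by
  set L := Submodule.span R ((fun b : ι → ℕ => ∏ j, x j ^ b j) ''
      {b | ∀ j, b j ≤ (α j + 1) * Q - 1}) ⊔ J.restrictScalars R
  have hJ {f : P} (hf : f ∈ J) : f ∈ L :=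
    (le_sup_right : J.restrictScalars R ≤ L) hf
  induction hd : ∑ j, B j using Nat.strong_induction_on generalizing B with
  | _ d ih =>
    have hlow : degreeLTSpan R x d ≤ L := by
      refine Submodule.span_le.2 ?_
      rintro _ ⟨B', hB', rfl⟩
      exact ih _ hB' B' rfl
    have hlead (c : ι → ℕ) : AgreesInDegree R x (∑ j, (c j * Q + B j % Q))
        ((∏ j, v j ^ c j) * ∏ j, x j ^ (B j % Q)) (∏ j, x j ^ (Q * c j + B j % Q)) := by
      have h0 (j : ι) : AgreesInDegree R x 1 (x j) (x j) := by
        simpa using AgreesInDegree.add_right R.zero_mem j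
      have := AgreesInDegree.prod Finset.univ fun j _ =>
        ((hv j).pow (c j)).mul ((h0 j).pow (B j % Q))
      simpa only [mul_one, Finset.prod_mul_distrib, pow_add, pow_mul] using this
    have hBc : ∑ j, (B j / Q * Q + B j % Q) = d := by
      rw [← hd]
      exact Finset.sum_congr rfl fun j _ => Nat.div_add_mod' _ _
    obtain ⟨y, hy, hyJ⟩ := hred fun j => B j / Q
    have hyL : y * ∏ j, x j ^ (B j % Q) ∈ L := by
      clear hyJ
      induction hy using Submodule.span_induction with
      | mem z hz =>
        obtain ⟨c, ⟨hcα, hcsum⟩, rfl⟩ := hz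
        have hl := hlead c
        have hsum : ∑ j, (c j * Q + B j % Q) = d := by
          rw [← hBc, Finset.sum_add_distrib, Finset.sum_add_distrib, ← Finset.sum_mul,
            ← Finset.sum_mul, hcsum]
        rw [hsum] at hl
        rw [← sub_add_cancel ((∏ j, v j ^ c j) * ∏ j, x j ^ (B j % Q))
          (∏ j, x j ^ (Q * c j + B j % Q))]
        refine L.add_mem (hlow hl.2.2) ((le_sup_left : _ ≤ L)
          (Submodule.subset_span ⟨_, fun j => ?_, rfl⟩))
        have h1 := Nat.mod_lt (B j) hQ
        have h2 := Nat.mul_le_mul_left Q (hcα j)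
        have h3 : (α j + 1) * Q = Q * α j + Q := by ring
        omega
      | zero => rw [zero_mul]; exact L.zero_mem
      | add y z _ _ hy hz => rw [add_mul]; exact L.add_mem hy hz
      | smul a z _ hz =>
        rw [smul_mul_assoc, ← algebraMap_smul R a]
        exact L.smul_mem _ hz
    have hl := hlead fun j => B j / Q
    rw [hBc] at hl
    simp only [Nat.div_add_mod] at hl
    have h1 : (∏ j, v j ^ (B j / Q)) * ∏ j, x j ^ (B j % Q) ∈ L := by
      have := L.add_mem (hJ (J.mul_mem_right (∏ j, x j ^ (B j % Q)) hyJ)) hyL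
      rwa [sub_mul, sub_add_cancel] at this
    have := L.sub_mem h1 (hlow hl.2.2)
    rwa [sub_sub_cancel] at this

end OneBlock

lemma adjoin_le_span_monomials (S : Set P) {ι : Type*} [Fintype ι] (x : ι → P) {f : P}
    (hf : f ∈ Algebra.adjoin K (S ∪ Set.range x)) :
    f ∈ Submodule.span (Algebra.adjoin K S) (Set.range fun B : ι → ℕ => ∏ j, x j ^ B j) := by
  classical
  have hone : (1 : P) ∈ Submodule.span (Algebra.adjoin K S)
      (Set.range fun B : ι → ℕ => ∏ j, x j ^ B j) := Submodule.subset_span ⟨0, by simp⟩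
  induction hf using Algebra.adjoin_induction with
  | mem f hf =>
    rcases hf with hf | ⟨j, rfl⟩
    · have := Submodule.smul_mem _ (⟨f, Algebra.subset_adjoin hf⟩ : Algebra.adjoin K S) hone
      rwa [Algebra.smul_def, mul_one] at this
    · refine Submodule.subset_span ⟨Pi.single j 1, ?_⟩
      simp only
      rw [Finset.prod_eq_single j]
      · simp
      · intro i _ hi
        simp [hi]
      · simp
  | algebraMap r =>
    rw [Algebra.algebraMap_eq_smul_one, ← algebraMap_smul (Algebra.adjoin K S) r]
    exact Submodule.smul_mem _ _ hone
  | add f g _ _ hf hg => exact add_mem hf hg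
  | mul f g _ _ hf hg =>
    have h := Submodule.mul_mem_mul hf hg
    rw [Submodule.span_mul_span] at h
    refine Submodule.span_mono ?_ h
    rintro _ ⟨_, ⟨B, rfl⟩, _, ⟨B', rfl⟩, rfl⟩
    exact ⟨B + B', by simp only [Pi.add_apply, pow_add, Finset.prod_mul_distrib]⟩

variable {l : ℕ} {ι : Fin l → Type*} [∀ i, Fintype (ι i)]

/-- The subalgebra generated by the variables in the first `k` blocks. -/
def initialAdjoin (K : Type*) [Field K] [Algebra K P] (x : ∀ i, ι i → P) (k : ℕ) :
    Subalgebra K P :=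
  Algebra.adjoin K {f | ∃ i j, i.val < k ∧ f = x i j}

lemma initialAdjoin_le_span_sup (x : ∀ i, ι i → P) (J : Ideal P) (β : ∀ i, ι i → ℕ)
    (hβ : ∀ i (B : ι i → ℕ), ∏ j, x i j ^ B j ∈
      Submodule.span (initialAdjoin K x i) ((fun b : ι i → ℕ => ∏ j, x i j ^ b j) ''
        {b | ∀ j, b j ≤ β i j}) ⊔ J.restrictScalars (initialAdjoin K x i))
    (k : ℕ) (hk : k ≤ l) {f : P} (hf : f ∈ initialAdjoin K x k) :
    f ∈ Submodule.span K ((fun b : ∀ i, ι i → ℕ => ∏ i, ∏ j, x i j ^ b i j) ''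
      {b | (∀ i j, b i j ≤ β i j) ∧ ∀ i, k ≤ i.val → b i = 0}) ⊔ J.restrictScalars K := by
  classical
  induction k generalizing f with
  | zero =>
    have : f ∈ (⊥ : Subalgebra K P) := by simpa [initialAdjoin] using hf
    obtain ⟨a, rfl⟩ := Algebra.mem_bot.1 this
    rw [Algebra.algebraMap_eq_smul_one]
    exact Submodule.smul_mem _ _ ((le_sup_left : _ ≤ _ ⊔ J.restrictScalars K)
      (Submodule.subset_span ⟨0, by simp, by simp⟩))
  | succ k ih =>
    let i₀ : Fin l := ⟨k, hk⟩
    set W := Submodule.span K ((fun b : ∀ i, ι i → ℕ => ∏ i, ∏ j, x i j ^ b i j) ''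
      {b | (∀ i j, b i j ≤ β i j) ∧ ∀ i, k + 1 ≤ i.val → b i = 0})
    set L := W ⊔ J.restrictScalars K
    have hJ {f : P} (hf : f ∈ J) : f ∈ L := (le_sup_right : J.restrictScalars K ≤ L) hf
    have hmono (b : ι i₀ → ℕ) (hb : ∀ j, b j ≤ β i₀ j) (w : P)
        (hw : w ∈ Submodule.span K ((fun b : ∀ i, ι i → ℕ => ∏ i, ∏ j, x i j ^ b i j) ''
          {b | (∀ i j, b i j ≤ β i j) ∧ ∀ i, k ≤ i.val → b i = 0})) :
        w * ∏ j, x i₀ j ^ b j ∈ W := by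
      induction hw using Submodule.span_induction with
      | mem w hw =>
        obtain ⟨b', ⟨hb'β, hb'0⟩, rfl⟩ := hw
        refine Submodule.subset_span ⟨Function.update b' i₀ b, ⟨fun i j => ?_, fun i hi => ?_⟩, ?_⟩
        · by_cases h : i = i₀
          · subst h
            simpa using hb j
          · simpa [h] using hb'β i j
        · have h : i ≠ i₀ := fun h => by
            rw [h] at hi
            exact absurd hi (by simp [i₀])
          simpa [h] using hb'0 i (by omega)
        · simp only
          rw [Fintype.prod_eq_mul_prod_compl i₀, Fintype.prod_eq_mul_prod_compl i₀
            (fun i => ∏ j, x i j ^ b' i j), hb'0 i₀ le_rfl, Function.update_self, mul_comm]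
          simp only [Pi.zero_apply, pow_zero, Finset.prod_const_one, one_mul]
          congr 1
          refine Finset.prod_congr rfl fun i hi => ?_
          rw [Function.update_of_ne (by simpa using hi)]
      | zero => rw [zero_mul]; exact W.zero_mem
      | add y z _ _ hy hz => rw [add_mul]; exact W.add_mem hy hz
      | smul a z _ hz => rw [smul_mul_assoc]; exact W.smul_mem _ hz
    have hgood (r : P) (hr : r ∈ initialAdjoin K x k) (b : ι i₀ → ℕ)
        (hb : ∀ j, b j ≤ β i₀ j) : r * ∏ j, x i₀ j ^ b j ∈ L := by
      obtain ⟨w, hw, z, hz, rfl⟩ := Submodule.mem_sup.1 (ih (by omega) hr)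
      rw [add_mul]
      exact L.add_mem ((le_sup_left : W ≤ L) (hmono b hb w hw)) (hJ (J.mul_mem_right _ hz))
    have hall (r : P) (hr : r ∈ initialAdjoin K x k) (B : ι i₀ → ℕ) :
        r * ∏ j, x i₀ j ^ B j ∈ L := by
      obtain ⟨y, hy, z, hz, hyz⟩ := Submodule.mem_sup.1 (hβ i₀ B)
      rw [← hyz, mul_add]
      refine L.add_mem ?_ (hJ (J.mul_mem_left _ hz))
      clear hyz
      induction hy using Submodule.span_induction generalizing r with
      | mem y hy =>
        obtain ⟨b, hb, rfl⟩ := hy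
        exact hgood r hr b hb
      | zero => rw [mul_zero]; exact L.zero_mem
      | add y z _ _ hy hz => rw [mul_add]; exact L.add_mem (hy r hr) (hz r hr)
      | smul a z _ hz =>
        rw [Algebra.smul_def, ← mul_assoc]
        exact hz _ (Subalgebra.mul_mem _ hr a.2)
    have hsub : initialAdjoin K x (k + 1) ≤
        Algebra.adjoin K ({f | ∃ i j, i.val < k ∧ f = x i j} ∪ Set.range (x i₀)) := by
      refine Algebra.adjoin_mono ?_
      rintro _ ⟨i, j, hi, rfl⟩
      rcases Nat.lt_succ_iff_lt_or_eq.1 hi with h | h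
      · exact Or.inl ⟨i, j, h, rfl⟩
      · obtain rfl : i = i₀ := Fin.ext h
        exact Or.inr ⟨j, rfl⟩
    have hspan := adjoin_le_span_monomials _ (x i₀) (hsub hf)
    have key (f : P) (hf : f ∈ Submodule.span (initialAdjoin K x k)
        (Set.range fun B : ι i₀ → ℕ => ∏ j, x i₀ j ^ B j)) :
        ∀ r ∈ initialAdjoin K x k, r * f ∈ L := by
      induction hf using Submodule.span_induction with
      | mem y hy =>
        obtain ⟨B, rfl⟩ := hy
        exact fun r hr => hall r hr B
      | zero => intro r _; rw [mul_zero]; exact L.zero_mem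
      | add y z _ _ hy hz => intro r hr; rw [mul_add]; exact L.add_mem (hy r hr) (hz r hr)
      | smul a z _ hz =>
        intro r hr
        rw [Algebra.smul_def, ← mul_assoc]
        exact hz _ (Subalgebra.mul_mem _ hr a.2)
    simpa using key f hspan 1 (Subalgebra.one_mem _)

end Triangular

section LinearizedPolynomial

variable {K : Type*} [Field K] {n : ℕ} {k : ℕ} (hk : k ≤ n)

lemma sum_C_mul_X_injective :
    Function.Injective fun c : Fin k → K =>
      (∑ i, C (c i) * X (Fin.castLE hk i) : MvPolynomial (Fin n) K) := by
  intro c d hcd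
  funext i
  have := congrArg (coeff (Finsupp.single (Fin.castLE hk i) 1)) hcd
  simpa [coeff_sum, coeff_C_mul, coeff_X, Finsupp.single_left_inj] using this

variable [Fintype K]

lemma Fpoly_add_sum (t : MvPolynomial (Fin n) K) (d : Fin k → K) :
    Fpoly K k hk (t + ∑ i, C (d i) * X (Fin.castLE hk i)) = Fpoly K k hk t := by
  refine Fintype.prod_equiv (Equiv.addLeft d) _ _ fun c => ?_
  simp only [Equiv.coe_addLeft, Pi.add_apply, map_add, add_mul, Finset.sum_add_distrib, add_assoc]

lemma Fpoly_zero : Fpoly K k hk 0 = 0 :=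
  Finset.prod_eq_zero (Finset.mem_univ 0) (by simp)

lemma Fpoly_sum_eq_zero (d : Fin k → K) :
    Fpoly K k hk (∑ i, C (d i) * X (Fin.castLE hk i)) = 0 := by
  rw [← zero_add (∑ i, _), Fpoly_add_sum, Fpoly_zero]

lemma Fpoly_X_eq_zero (s : Fin n) (hs : s.val < k) : Fpoly K k hk (X s) = 0 := by
  have h := Fpoly_sum_eq_zero (K := K) hk (Pi.single ⟨s, hs⟩ 1)
  rw [Finset.sum_eq_single ⟨s, hs⟩] at h
  · simpa using h
  · intro i _ hi
    simp [hi]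
  · simp

lemma Fpoly_add (t y : MvPolynomial (Fin n) K) :
    Fpoly K k hk (t + y) = Fpoly K k hk t + Fpoly K k hk y := by
  classical
  let u (c : Fin k → K) : MvPolynomial (Fin n) K := ∑ i, C (c i) * X (Fin.castLE hk i)
  let q (z : MvPolynomial (Fin n) K) : Polynomial (MvPolynomial (Fin n) K) :=
    ∏ c, (Polynomial.X + Polynomial.C (z + u c))
  have heval (z w) : (q z).eval w = Fpoly K k hk (w + z) := by
    simp only [q, Polynomial.eval_prod, Polynomial.eval_add, Polynomial.eval_X,
      Polynomial.eval_C, Fpoly, u, add_assoc]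
  have hmonic (z) : (q z).Monic := Polynomial.monic_prod_of_monic _ _ fun c _ =>
    Polynomial.monic_X_add_C _
  have hdeg (z) : (q z).degree = Fintype.card (Fin k → K) := by
    simp only [q, Polynomial.degree_prod, Polynomial.degree_X_add_C, Finset.sum_const,
      Finset.card_univ, nsmul_eq_mul, mul_one]
  have hpos : 0 < Fintype.card (Fin k → K) := Fintype.card_pos
  have hlt : (Polynomial.C (Fpoly K k hk y)).degree < (q 0).degree := by
    rw [hdeg]
    exact Polynomial.degree_C_le.trans_lt (by exact_mod_cast hpos)
  have h : q y = q 0 + Polynomial.C (Fpoly K k hk y) := by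
    refine Polynomial.eq_of_degree_sub_lt_of_eval_index_eq Finset.univ
      (v := u) ((sum_C_mul_X_injective hk).injOn) ?_ fun c _ => ?_
    · have := Polynomial.degree_sub_lt_left (p := q y) (q := q 0 + Polynomial.C (Fpoly K k hk y))
        (by rw [Polynomial.degree_add_eq_left_of_degree_lt hlt, hdeg, hdeg])
        (hmonic y).ne_zero
        (by rw [(hmonic y).leadingCoeff, ((hmonic 0).add_of_left hlt).leadingCoeff])
      rwa [hdeg, ← Finset.card_univ] at this
    · rw [Polynomial.eval_add, heval, heval, Polynomial.eval_C, add_zero, add_comm (u c),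
        Fpoly_add_sum, Fpoly_sum_eq_zero, zero_add]
  rw [← heval, h, Polynomial.eval_add, heval, Polynomial.eval_C, add_zero]

lemma Fpoly_C_mul (a : K) (t : MvPolynomial (Fin n) K) :
    Fpoly K k hk (C a * t) = C a * Fpoly K k hk t := by
  by_cases ha : a = 0
  · simp [ha, Fpoly_zero]
  have h : ∏ c : Fin k → K, (C a * (t + ∑ i, C (c i) * X (Fin.castLE hk i))) =
      Fpoly K k hk (C a * t) := by
    refine Fintype.prod_equiv (Equiv.piCongrRight fun _ => Equiv.mulLeft₀ a ha) _ _ fun c => ?_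
    simp [mul_add, Finset.mul_sum, mul_assoc]
  rw [← h, Finset.prod_mul_distrib, Finset.prod_const, Finset.card_univ, Fintype.card_fun,
    Fintype.card_fin, ← C_pow, FiniteField.pow_card_pow]
  rfl

lemma Fpoly_sum {ι : Type*} (s : Finset ι) (a : ι → K) (t : ι → MvPolynomial (Fin n) K) :
    Fpoly K k hk (∑ i ∈ s, C (a i) * t i) = ∑ i ∈ s, C (a i) * Fpoly K k hk (t i) := by
  classical
  induction s using Finset.induction_on with
  | empty => simp [Fpoly_zero]
  | insert i s hi ih => rw [Finset.sum_insert hi, Finset.sum_insert hi, Fpoly_add, Fpoly_C_mul, ih]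

lemma Fpoly_isHomogeneous {t : MvPolynomial (Fin n) K} (ht : t.IsHomogeneous 1) :
    (Fpoly K k hk t).IsHomogeneous (Fintype.card K ^ k) := by
  have := IsHomogeneous.prod (Finset.univ : Finset (Fin k → K))
    (fun c => t + ∑ i, C (c i) * X (Fin.castLE hk i)) (fun _ => 1) fun c _ =>
      ht.add (IsHomogeneous.sum _ _ _ fun i _ => isHomogeneous_C_mul_X _ _)
  simpa [Fpoly] using this

lemma matAct_Fpoly (g : GL (Fin n) K)
    (hg : ∀ s t : Fin n, t.val < k → k ≤ s.val → (g : Matrix (Fin n) (Fin n) K) s t = 0)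
    (t : MvPolynomial (Fin n) K) :
    matAct (g : Matrix (Fin n) (Fin n) K) (Fpoly K k hk t) =
      Fpoly K k hk (matAct (g : Matrix (Fin n) (Fin n) K) t) := by
  let φ (c : Fin k → K) (s : Fin k) : K :=
    ∑ i, (g : Matrix (Fin n) (Fin n) K) (Fin.castLE hk s) (Fin.castLE hk i) * c i
  have hφ (c : Fin k → K) : matAct (g : Matrix (Fin n) (Fin n) K)
      (∑ i, C (c i) * X (Fin.castLE hk i)) = ∑ i, C (φ c i) * X (Fin.castLE hk i) := by
    simp only [map_sum, map_mul, matAct_X, algHom_C, algebraMap_eq, φ, Finset.sum_mul,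
      Finset.mul_sum]
    rw [Finset.sum_comm' (t' := Finset.univ) (s' := fun _ => Finset.univ) (by simp)]
    refine (Fintype.sum_of_injective (Fin.castLE hk) (Fin.castLE_injective hk) _ _
      (fun s hs => Finset.sum_eq_zero fun i _ => ?_)
      fun s => Finset.sum_congr rfl fun i _ => by ring).symm
    have hks : k ≤ s.val := by
      by_contra h
      exact hs ⟨⟨s, by omega⟩, rfl⟩
    simp [hg s (Fin.castLE hk i) i.2 hks]
  have hinj : Function.Injective φ := fun c d hcd => by
    refine sum_C_mul_X_injective hk (matAct_GL_injective g ?_)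
    simp only [hφ, hcd]
  rw [Fpoly, map_prod]
  refine Fintype.prod_bijective φ (Finite.injective_iff_bijective.1 hinj) _ _ fun c => ?_
  rw [map_add, hφ]

end LinearizedPolynomial

section Blocks

variable {K : Type*} [Field K] {l n : ℕ} {m : Fin (l + 1) → ℕ}

lemma exists_emb_eq (hm0 : m 0 = 0) (hmono : StrictMono m) (hlast : m (Fin.last l) = n)
    (s : Fin n) : ∃ i j, emb n m hmono hlast i j = s := by
  suffices ∀ k : Fin (l + 1), s.val < m k → ∃ i j, emb n m hmono hlast i j = s from
    this (Fin.last l) (hlast ▸ s.2)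
  intro k
  induction k using Fin.induction with
  | zero => intro h; omega
  | succ i ih =>
    intro h
    by_cases h' : s.val < m i.castSucc
    · exact ih h'
    · exact ⟨i, ⟨s.val - m i.castSucc, by omega⟩, Fin.ext (by simp only [emb]; omega)⟩

lemma tauf_le (s : ℕ) : tauf m s ≤ s :=
  Finset.sup_le fun _ hi => (Finset.mem_filter.1 hi).2

lemma le_tauf {s : ℕ} {i : Fin (l + 1)} (h : m i ≤ s) : m i ≤ tauf m s :=
  Finset.le_sup (f := m) (by simpa using h)

lemma tauf_emb (hmono : StrictMono m) (hlast : m (Fin.last l) = n) (i : Fin l)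
    (j : Fin (m i.succ - m i.castSucc)) :
    tauf m (emb n m hmono hlast i j) = m i.castSucc := by
  have h := j.2
  refine le_antisymm (Finset.sup_le fun k hk => hmono.monotone ?_)
    (le_tauf (Nat.le_add_right _ _))
  have hk' : m k < m i.succ := by
    have : m k ≤ m i.castSucc + j := (Finset.mem_filter.1 hk).2
    omega
  exact Fin.le_castSucc_iff.2 (hmono.lt_iff_lt.1 hk')

lemma emb_injective (hmono : StrictMono m) (hlast : m (Fin.last l) = n) :
    Function.Injective fun a : (Σ i : Fin l, Fin (m i.succ - m i.castSucc)) =>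
      emb n m hmono hlast a.1 a.2 := by
  rintro ⟨i, j⟩ ⟨i', j'⟩ h
  have h1 := congrArg (fun s : Fin n => tauf m s) h
  simp only [tauf_emb] at h1
  obtain rfl : i = i' := Fin.castSucc_injective l (hmono.injective h1)
  have h2 := congrArg Fin.val h
  simp only [emb] at h2
  obtain rfl : j = j' := Fin.ext (by omega)
  rfl

lemma apply_eq_zero_of_mem_GSet {hmono : StrictMono m} {hlast : m (Fin.last l) = n}
    {G : (i : Fin l) → Subgroup (GL (Fin (m i.succ - m i.castSucc)) K)} {g : GL (Fin n) K}
    (hg : g ∈ GSet K n m hmono hlast G) (k : Fin (l + 1)) {s t : Fin n} (ht : t.val < m k)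
    (hs : m k ≤ s.val) : (g : Matrix (Fin n) (Fin n) K) s t = 0 :=
  hg.1 s t ((tauf_le _).trans_lt (ht.trans_le (le_tauf hs)))

variable [Fintype K]

lemma matAct_vij {hmono : StrictMono m} {hlast : m (Fin.last l) = n}
    {G : (i : Fin l) → Subgroup (GL (Fin (m i.succ - m i.castSucc)) K)} {g : GL (Fin n) K}
    (hg : g ∈ GSet K n m hmono hlast G) (i : Fin l)
    (k : Fin (m i.succ - m i.castSucc)) :
    matAct (g : Matrix (Fin n) (Fin n) K) (vij K n m hmono hlast i k) =
      ∑ j, C ((g : Matrix (Fin n) (Fin n) K) (emb n m hmono hlast i j)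
        (emb n m hmono hlast i k)) * vij K n m hmono hlast i j := by
  rw [vij, matAct_Fpoly _ g fun s t => apply_eq_zero_of_mem_GSet hg i.castSucc, matAct_X, Fpoly_sum]
  refine (Fintype.sum_of_injective (emb n m hmono hlast i) ?_ _ _ (fun s hs => ?_)
    fun j => rfl).symm
  · intro j j' h
    have h2 := congrArg Fin.val h
    simp only [emb] at h2
    exact Fin.ext (by omega)
  · by_cases h1 : s.val < m i.castSucc
    · rw [Fpoly_X_eq_zero _ s h1, mul_zero]
    · have h2 : m i.succ ≤ s.val := by
        by_contra h2
        exact hs ⟨⟨s.val - m i.castSucc, by omega⟩, Fin.ext (by simp only [emb]; omega)⟩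
      have hk := k.2
      rw [apply_eq_zero_of_mem_GSet hg i.succ (by simp only [emb]; omega) h2, map_zero, zero_mul]

lemma vij_isHomogeneous (hmono : StrictMono m) (hlast : m (Fin.last l) = n) (i : Fin l)
    (j : Fin (m i.succ - m i.castSucc)) :
    (vij K n m hmono hlast i j).IsHomogeneous (Fintype.card K ^ m i.castSucc) :=
  Fpoly_isHomogeneous _ (isHomogeneous_X _ _)

lemma aeval_vij_mem_invariants {hmono : StrictMono m} {hlast : m (Fin.last l) = n}
    {G : (i : Fin l) → Subgroup (GL (Fin (m i.succ - m i.castSucc)) K)} (i : Fin l)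
    {f : MvPolynomial (Fin (m i.succ - m i.castSucc)) K} (hf : f ∈ invariants (G i : Set _)) :
    aeval (vij K n m hmono hlast i) f ∈ invariants (GSet K n m hmono hlast G) := by
  intro g hg
  obtain ⟨h, hh, hgh⟩ := hg.2 i
  suffices (matAct (g : Matrix (Fin n) (Fin n) K)).comp (aeval (vij K n m hmono hlast i)) =
      (aeval (vij K n m hmono hlast i)).comp (matAct (h : Matrix _ _ K)) by
    have := DFunLike.congr_fun this f
    rwa [AlgHom.comp_apply, AlgHom.comp_apply, hf h hh] at this
  refine MvPolynomial.algHom_ext fun k => ?_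
  simp [matAct_vij hg, matAct_X, hgh]

lemma aeval_vij_mem_coinvIdeal {hmono : StrictMono m} {hlast : m (Fin.last l) = n}
    {G : (i : Fin l) → Subgroup (GL (Fin (m i.succ - m i.castSucc)) K)} (i : Fin l)
    {f : MvPolynomial (Fin (m i.succ - m i.castSucc)) K} (hf : f ∈ coinvIdeal (G i : Set _)) :
    aeval (vij K n m hmono hlast i) f ∈ coinvIdeal (GSet K n m hmono hlast G) := by
  have hle : coinvIdeal (G i : Set _) ≤ (coinvIdeal (GSet K n m hmono hlast G)).comap
      (aeval (vij K n m hmono hlast i)) := Ideal.span_le.2 fun f hf =>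
    Ideal.subset_span ⟨aeval_vij_mem_invariants i hf.1,
      have ⟨_, hd, hfd⟩ := hf.2
      ⟨_, Nat.mul_pos (pow_pos Fintype.card_pos _) hd,
        hfd.aeval _ (vij_isHomogeneous hmono hlast i)⟩⟩
  exact hle hf

end Blocks

section BlockBasis

variable {K : Type*} [Field K] {l n : ℕ} {m : Fin (l + 1) → ℕ}

/-- The block upper triangular matrix with diagonal blocks `H` and entries `w` above them, indexed
by pairs of a block and a position in it. -/
def blockMatrix (hmono : StrictMono m) (hlast : m (Fin.last l) = n)
    (H : (i : Fin l) → Matrix (Fin (m i.succ - m i.castSucc)) (Fin (m i.succ - m i.castSucc)) K)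
    (w : (i : Fin l) → Fin (m i.succ - m i.castSucc) → Fin (m i.castSucc) → K) :
    Matrix (Σ i : Fin l, Fin (m i.succ - m i.castSucc))
      (Σ i : Fin l, Fin (m i.succ - m i.castSucc)) K := fun a b =>
  if h : a.1 = b.1 then H b.1 (h ▸ a.2) b.2
  else if h : (emb n m hmono hlast a.1 a.2).val < m b.1.castSucc then w b.1 b.2 ⟨_, h⟩ else 0

lemma lt_of_emb_lt (hmono : StrictMono m) (hlast : m (Fin.last l) = n) {i k : Fin l}
    {j : Fin (m i.succ - m i.castSucc)} (h : (emb n m hmono hlast i j).val < m k.castSucc) :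
    i < k := by
  have : m i.castSucc < m k.castSucc := by
    simp only [emb] at h
    omega
  exact Fin.castSucc_lt_castSucc_iff.1 (hmono.lt_iff_lt.1 this)

lemma blockMatrix_self (hmono : StrictMono m) (hlast : m (Fin.last l) = n)
    (H : (i : Fin l) → Matrix (Fin (m i.succ - m i.castSucc)) (Fin (m i.succ - m i.castSucc)) K)
    (w : (i : Fin l) → Fin (m i.succ - m i.castSucc) → Fin (m i.castSucc) → K) (i : Fin l)
    (j k : Fin (m i.succ - m i.castSucc)) :
    blockMatrix hmono hlast H w ⟨i, j⟩ ⟨i, k⟩ = H i j k := by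
  simp [blockMatrix]

lemma blockMatrix_blockTriangular (hmono : StrictMono m) (hlast : m (Fin.last l) = n)
    (H : (i : Fin l) → Matrix (Fin (m i.succ - m i.castSucc)) (Fin (m i.succ - m i.castSucc)) K)
    (w : (i : Fin l) → Fin (m i.succ - m i.castSucc) → Fin (m i.castSucc) → K) :
    (blockMatrix hmono hlast H w).BlockTriangular Sigma.fst := fun a b hab => by
  rw [blockMatrix, dif_neg hab.ne', dif_neg fun h => (lt_of_emb_lt hmono hlast h).not_gt hab]

lemma det_blockMatrix (hmono : StrictMono m) (hlast : m (Fin.last l) = n)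
    (H : (i : Fin l) → Matrix (Fin (m i.succ - m i.castSucc)) (Fin (m i.succ - m i.castSucc)) K)
    (w : (i : Fin l) → Fin (m i.succ - m i.castSucc) → Fin (m i.castSucc) → K) :
    (blockMatrix hmono hlast H w).det = ∏ i, (H i).det := by
  rw [(blockMatrix_blockTriangular hmono hlast H w).det_fintype]
  refine Finset.prod_congr rfl fun i _ => ?_
  rw [← Matrix.det_submatrix_equiv_self (Equiv.sigmaSubtype i).symm]
  congr 1
  ext j k
  exact blockMatrix_self hmono hlast H w i j k

lemma le_card_GSet [Fintype K] (hm0 : m 0 = 0) (hmono : StrictMono m)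
    (hlast : m (Fin.last l) = n)
    (G : (i : Fin l) → Subgroup (GL (Fin (m i.succ - m i.castSucc)) K)) :
    ∏ i, Nat.card (G i) * Fintype.card K ^ (m i.castSucc * (m i.succ - m i.castSucc)) ≤
      Nat.card (GSet K n m hmono hlast G) := by
  let e : (Σ i : Fin l, Fin (m i.succ - m i.castSucc)) ≃ Fin n :=
    Equiv.ofBijective (fun a => emb n m hmono hlast a.1 a.2)
      ⟨emb_injective hmono hlast, fun s =>
        have ⟨i, j, h⟩ := exists_emb_eq hm0 hmono hlast s
        ⟨⟨i, j⟩, h⟩⟩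
  let M (a : ((i : Fin l) → G i) ×
      ((i : Fin l) → Fin (m i.succ - m i.castSucc) → Fin (m i.castSucc) → K)) :
      Matrix (Σ i : Fin l, Fin (m i.succ - m i.castSucc))
        (Σ i : Fin l, Fin (m i.succ - m i.castSucc)) K :=
    blockMatrix hmono hlast (fun i => (a.1 i).1.1) a.2
  have hdet (a) : IsUnit ((M a).submatrix e.symm e.symm).det := by
    rw [Matrix.det_submatrix_equiv_self, det_blockMatrix]
    exact (Finset.prod_ne_zero_iff.2 fun i _ =>
      ((Matrix.isUnit_iff_isUnit_det _).1 (Units.isUnit (a.1 i).1)).ne_zero).isUnit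
  let g (a) : GL (Fin n) K := Matrix.nonsingInvUnit _ (hdet a)
  have hg (a) (i k : Fin l) (j) (j') : (g a : Matrix (Fin n) (Fin n) K)
      (emb n m hmono hlast i j) (emb n m hmono hlast k j') = M a ⟨i, j⟩ ⟨k, j'⟩ := by
    change M a (e.symm (e ⟨i, j⟩)) (e.symm (e ⟨k, j'⟩)) = _
    rw [e.symm_apply_apply, e.symm_apply_apply]
  have hmem (a) : g a ∈ GSet K n m hmono hlast G := by
    refine ⟨fun s t hst => ?_, fun i => ⟨a.1 i, (a.1 i).2, fun j k => ?_⟩⟩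
    · obtain ⟨i, j, rfl⟩ := exists_emb_eq hm0 hmono hlast s
      obtain ⟨i', j', rfl⟩ := exists_emb_eq hm0 hmono hlast t
      rw [tauf_emb, tauf_emb] at hst
      rw [hg]
      exact blockMatrix_blockTriangular hmono hlast _ _
        (Fin.castSucc_lt_castSucc_iff.1 (hmono.lt_iff_lt.1 hst))
    · rw [hg]
      exact blockMatrix_self hmono hlast _ _ i j k
  have hinj : Function.Injective fun a => (⟨g a, hmem a⟩ : GSet K n m hmono hlast G) := by
    intro a b hab
    have hgab : g a = g b := congrArg Subtype.val hab
    have hM : M a = M b := by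
      ext ⟨i, j⟩ ⟨k, j'⟩
      rw [← hg, ← hg, hgab]
    refine Prod.ext (funext fun i => ?_) (funext fun i => funext fun j => funext fun s => ?_)
    · refine Subtype.ext (Units.ext (Matrix.ext fun j k => ?_))
      have := congrFun (congrFun hM ⟨i, j⟩) ⟨i, k⟩
      simpa only [M, blockMatrix_self] using this
    · obtain ⟨i', j', h⟩ := exists_emb_eq hm0 hmono hlast
        (⟨s, s.2.trans_le (hlast ▸ hmono.monotone (Fin.le_last _))⟩ : Fin n)
      have hs : (emb n m hmono hlast i' j').val = s.val := congrArg Fin.val h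
      have hlt : (emb n m hmono hlast i' j').val < m i.castSucc := hs ▸ s.2
      have := congrFun (congrFun hM ⟨i', j'⟩) ⟨i, j⟩
      simp only [M, blockMatrix, dif_neg (lt_of_emb_lt hmono hlast hlt).ne, dif_pos hlt] at this
      simpa only [hs] using this
  have := Nat.card_le_card_of_injective _ hinj
  refine le_of_eq_of_le ?_ this
  simp [Nat.card_pi, Finset.prod_mul_distrib, pow_mul]

lemma mem_span_sup_coinvIdeal {ι : Type*} {G : Set (GL (Fin n) K)} {e : ι → MvPolynomial (Fin n) K}
    (he : Submodule.span (invariants G) (Set.range e) = ⊤) (f : MvPolynomial (Fin n) K) :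
    f ∈ Submodule.span K (Set.range e) ⊔ (coinvIdeal G).restrictScalars K := by
  have hf : f ∈ Submodule.span (invariants G) (Set.range e) := by
    rw [he]
    exact Submodule.mem_top
  induction hf using Submodule.span_induction with
  | mem x hx =>
    exact (le_sup_left : _ ≤ _ ⊔ (coinvIdeal G).restrictScalars K) (Submodule.subset_span hx)
  | zero => exact zero_mem _
  | add x y _ _ hx hy => exact add_mem hx hy
  | smul a x _ hx =>
    have h : a • x = (a.1 - C (coeff 0 a.1)) * x + (coeff 0 a.1) • x := by
      rw [sub_mul, ← smul_eq_C_mul, sub_add_cancel]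
      rfl
    rw [h]
    exact add_mem ((le_sup_right : _ ≤ _ ⊔ (coinvIdeal G).restrictScalars K)
      (Ideal.mul_mem_right _ _ (sub_C_mem_coinvIdeal a.2))) (Submodule.smul_mem _ _ hx)

lemma isHomogeneous_prod_X_pow (c : Fin n → ℕ) :
    (∏ j, X j ^ c j : MvPolynomial (Fin n) K).IsHomogeneous (∑ j, c j) :=
  IsHomogeneous.prod _ _ _ fun j _ => isHomogeneous_X_pow j (c j)

lemma exists_sub_mem_coinvIdeal {G : Set (GL (Fin n) K)} {α : Fin n → ℕ}
    (hspan : Submodule.span (invariants G)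
      (Set.range (fun c : {c : Fin n → ℕ // ∀ j, c j ≤ α j} =>
        (∏ j, X j ^ c.1 j : MvPolynomial (Fin n) K))) = ⊤) (c : Fin n → ℕ) :
    ∃ y ∈ Submodule.span K ((fun c' : Fin n → ℕ => (∏ j, X j ^ c' j : MvPolynomial (Fin n) K)) ''
      {c' | (∀ j, c' j ≤ α j) ∧ ∑ j, c' j = ∑ j, c j}), ∏ j, X j ^ c j - y ∈ coinvIdeal G := by
  obtain ⟨y, hy, z, hz, hyz⟩ := Submodule.mem_sup.1
    (mem_span_sup_coinvIdeal hspan (∏ j, X j ^ c j))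
  refine ⟨homogeneousComponent (∑ j, c j) y, ?_, ?_⟩
  · clear hyz
    induction hy using Submodule.span_induction with
    | mem x hx =>
      obtain ⟨c', rfl⟩ := hx
      rw [homogeneousComponent_of_mem (isHomogeneous_prod_X_pow c'.1)]
      split_ifs with h
      · exact Submodule.subset_span ⟨c'.1, ⟨c'.2, h.symm⟩, rfl⟩
      · exact zero_mem _
    | zero => rw [map_zero]; exact zero_mem _
    | add x y _ _ hx hy => rw [map_add]; exact add_mem hx hy
    | smul a x _ hx => rw [map_smul]; exact Submodule.smul_mem _ _ hx
  · have h := homogeneousComponent_mem_coinvIdeal hz (∑ j, c j)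
    rw [eq_sub_iff_add_eq'.2 hyz, map_sub] at h
    rwa [homogeneousComponent_eq_self (isHomogeneous_prod_X_pow c)] at h

lemma linearIndependent_mk_of_card_le [Finite K] {ι : Type*} [Fintype ι] (G : Set (GL (Fin n) K))
    (e : ι → MvPolynomial (Fin n) K) (he : ∀ i, ∃ d, (e i).IsHomogeneous d)
    (hspan : ∀ f, f ∈ Submodule.span K (Set.range e) ⊔ (coinvIdeal G).restrictScalars K)
    (hcard : Fintype.card ι ≤ Nat.card G) :
    LinearIndependent K fun i => Ideal.Quotient.mk (coinvIdeal G) (e i) := by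
  classical
  have := Fintype.ofFinite G
  rw [linearIndependent_iff_notMem_span]
  intro i₀ hi₀
  let e' (i : {i // i ≠ i₀}) : MvPolynomial (Fin n) K := e i
  set L := Submodule.span K (Set.range e') ⊔ (coinvIdeal G).restrictScalars K
  have hi₀L : e i₀ ∈ L := by
    have himage : (fun i => Ideal.Quotient.mk (coinvIdeal G) (e i)) '' (Set.univ \ {i₀}) =
        (Ideal.Quotient.mkₐ K (coinvIdeal G)).toLinearMap '' Set.range e' := by
      ext z
      simp [e']
    rw [himage, ← Submodule.map_span] at hi₀
    obtain ⟨y, hy, hyz⟩ := hi₀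
    have h : e i₀ - y ∈ coinvIdeal G := Ideal.Quotient.eq.1 hyz.symm
    rw [← add_sub_cancel y (e i₀)]
    exact L.add_mem ((le_sup_left : _ ≤ L) hy)
      ((le_sup_right : (coinvIdeal G).restrictScalars K ≤ L) h)
  have hle : Submodule.span K (Set.range e) ⊔ (coinvIdeal G).restrictScalars K ≤ L := by
    refine sup_le (Submodule.span_le.2 ?_) le_sup_right
    rintro _ ⟨i, rfl⟩
    by_cases hi : i = i₀
    · exact hi ▸ hi₀L
    · exact (le_sup_left : _ ≤ L) (Submodule.subset_span ⟨⟨i, hi⟩, rfl⟩)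
  have htop := span_invariants_eq_top G e' (fun i => he i) fun f => by
    obtain ⟨y, hy, z, hz, hyz⟩ := Submodule.mem_sup.1 (hle (hspan f))
    exact ⟨y, hy, by rw [← hyz, add_sub_cancel_left]; exact hz⟩
  have h := card_le_of_span_invariants_eq_top G e' htop
  rw [Nat.card_eq_fintype_card] at hcard
  have hlt : Fintype.card {i // i ≠ i₀} < Fintype.card ι :=
    Fintype.card_subtype_lt (x := i₀) (by simp)
  omega

lemma span_mk_eq_top {ι : Type*} (I : Ideal (MvPolynomial (Fin n) K))
    (e : ι → MvPolynomial (Fin n) K)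
    (hspan : ∀ f, f ∈ Submodule.span K (Set.range e) ⊔ I.restrictScalars K) :
    Submodule.span K (Set.range fun i => Ideal.Quotient.mk I (e i)) = ⊤ := by
  refine eq_top_iff.2 fun z _ => ?_
  obtain ⟨f, rfl⟩ := Ideal.Quotient.mk_surjective z
  obtain ⟨y, hy, w, hw, rfl⟩ := Submodule.mem_sup.1 (hspan f)
  rw [map_add, Ideal.Quotient.eq_zero_iff_mem.2 hw, add_zero]
  have := Submodule.mem_map_of_mem (f := (Ideal.Quotient.mkₐ K I).toLinearMap) hy
  rwa [Submodule.map_span, ← Set.range_comp] at this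

variable [Fintype K]

lemma agreesInDegree_vij (hm0 : m 0 = 0) (hmono : StrictMono m) (hlast : m (Fin.last l) = n)
    (i : Fin l) (j : Fin (m i.succ - m i.castSucc)) :
    AgreesInDegree (initialAdjoin K
        (fun i j => (X (emb n m hmono hlast i j) : MvPolynomial (Fin n) K)) i)
      (fun j => X (emb n m hmono hlast i j)) (Fintype.card K ^ m i.castSucc)
      (vij K n m hmono hlast i j) (X (emb n m hmono hlast i j) ^ Fintype.card K ^ m i.castSucc) := by
  have hle : m i.castSucc ≤ n := hlast ▸ hmono.monotone (Fin.le_last _)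
  have h := AgreesInDegree.prod (Finset.univ : Finset (Fin (m i.castSucc) → K)) fun c _ =>
    AgreesInDegree.add_right (R := initialAdjoin K
        (fun i j => (X (emb n m hmono hlast i j) : MvPolynomial (Fin n) K)) i)
      (x := fun j => X (emb n m hmono hlast i j))
      (u := ∑ s, C (c s) * X (Fin.castLE hle s)) (Subalgebra.sum_mem _ fun s _ => ?_) j
  · simpa [vij, Fpoly] using h
  · obtain ⟨i', j', hs⟩ := exists_emb_eq hm0 hmono hlast (Fin.castLE hle s)
    refine Subalgebra.mul_mem _ (Subalgebra.algebraMap_mem _ _)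
      (Algebra.subset_adjoin ⟨i', j', lt_of_emb_lt hmono hlast (j := j') ?_, congrArg X hs.symm⟩)
    rw [hs]
    exact s.2

lemma mem_span_monomials_sup_coinvIdeal (hm0 : m 0 = 0) (hmono : StrictMono m)
    (hlast : m (Fin.last l) = n)
    (G : (i : Fin l) → Subgroup (GL (Fin (m i.succ - m i.castSucc)) K))
    (α : (i : Fin l) → Fin (m i.succ - m i.castSucc) → ℕ)
    (hspan : ∀ i : Fin l,
      Submodule.span (invariants ((G i : Set (GL (Fin (m i.succ - m i.castSucc)) K))))
        (Set.range (fun c : {c : Fin (m i.succ - m i.castSucc) → ℕ // ∀ j, c j ≤ α i j} =>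
          (∏ j, X j ^ c.1 j : MvPolynomial (Fin (m i.succ - m i.castSucc)) K))) = ⊤)
    (f : MvPolynomial (Fin n) K) :
    f ∈ Submodule.span K (Set.range fun b : {b : (i : Fin l) → Fin (m i.succ - m i.castSucc) → ℕ //
          ∀ i j, b i j ≤ (α i j + 1) * Fintype.card K ^ m i.castSucc - 1} =>
        (∏ i : Fin l, ∏ j, X (emb n m hmono hlast i j) ^ b.1 i j : MvPolynomial (Fin n) K)) ⊔
      (coinvIdeal (GSet K n m hmono hlast G)).restrictScalars K := by
  have hblock (i : Fin l) (B : Fin (m i.succ - m i.castSucc) → ℕ) :=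
    prod_pow_mem_span_sup (pow_pos (Fintype.card_pos (α := K)) (m i.castSucc))
      (agreesInDegree_vij (K := K) hm0 hmono hlast i)
      (J := coinvIdeal (GSet K n m hmono hlast G)) (α := α i) (fun c => by
        obtain ⟨y, hy, hyJ⟩ := exists_sub_mem_coinvIdeal (hspan i) c
        refine ⟨aeval (vij K n m hmono hlast i) y, ?_, ?_⟩
        · have := Submodule.mem_map_of_mem
            (f := (aeval (vij K n m hmono hlast i) : _ →ₐ[K] _).toLinearMap) hy
          rw [Submodule.map_span, Set.image_image] at this
          simpa using this
        · simpa using aeval_vij_mem_coinvIdeal (n := n) (hmono := hmono) (hlast := hlast) i hyJ) B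
  have hf : f ∈ initialAdjoin K
      (fun i j => (X (emb n m hmono hlast i j) : MvPolynomial (Fin n) K)) l := by
    have htop : f ∈ Algebra.adjoin K (Set.range (X : Fin n → MvPolynomial (Fin n) K)) := by
      rw [adjoin_range_X]
      exact Algebra.mem_top
    refine Algebra.adjoin_mono ?_ htop
    rintro _ ⟨s, rfl⟩
    obtain ⟨i, j, rfl⟩ := exists_emb_eq hm0 hmono hlast s
    exact ⟨i, j, i.2, rfl⟩
  obtain ⟨y, hy, z, hz, rfl⟩ := Submodule.mem_sup.1
    (initialAdjoin_le_span_sup _ _ _ hblock l le_rfl hf)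
  refine Submodule.add_mem_sup (Submodule.span_mono ?_ hy) hz
  rintro _ ⟨b, hb, rfl⟩
  exact ⟨⟨b, hb.1⟩, rfl⟩

lemma finite_subtype_forall_le {ι : Type*} [Finite ι] (β : ι → ℕ) :
    Finite {c : ι → ℕ // ∀ j, c j ≤ β j} :=
  have (j : ι) : Finite {x // x ≤ β j} := Set.finite_Iic (β j)
  Finite.of_equiv _ (Equiv.subtypePiEquivPi (p := fun j x => x ≤ β j)).symm

lemma card_subtype_forall_le {ι : Type*} [Fintype ι] (β : ι → ℕ) :
    Nat.card {c : ι → ℕ // ∀ j, c j ≤ β j} = ∏ j, (β j + 1) := by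
  rw [Nat.card_congr (Equiv.subtypePiEquivPi (p := fun j x => x ≤ β j)), Nat.card_pi]
  refine Finset.prod_congr rfl fun j _ => ?_
  have : Nat.card (Set.Iic (β j)) = β j + 1 := by simp
  exact this

end BlockBasis

/-- suppose that for each `i` the monomial factors of
`x_{m_{i-1}+1}^{α_{i,1}} ⋯ x_{m_i}^{α_{i,n_i}}` form a basis of `P_i` as a module
over `P_i^{G_i}`.  Then the monomial `Π_{i,j} x_{m_{i-1}+j}^{(α_{i,j}+1)q^{m_{i-1}}-1}`
generates a block basis for the coinvariant algebra `P_{G_I}`: its monomial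
factors project to an `F_q`-basis of `P/I_{G_I}`. -/
theorem statement16 {K : Type*} [Field K] [Fintype K] {p r : ℕ} (hp : p.Prime)
    (hr : 0 < r) (hcard : Fintype.card K = p ^ r)
    (n l : ℕ) (hl : 0 < l) (m : Fin (l + 1) → ℕ)
    (hm0 : m 0 = 0) (hmono : StrictMono m) (hlast : m (Fin.last l) = n)
    (G : (i : Fin l) → Subgroup (GL (Fin (m i.succ - m i.castSucc)) K))
    (α : (i : Fin l) → Fin (m i.succ - m i.castSucc) → ℕ)
    (hbasis : ∀ i : Fin l,
      LinearIndependent (invariants ((G i : Set (GL (Fin (m i.succ - m i.castSucc)) K))))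
        (fun c : {c : Fin (m i.succ - m i.castSucc) → ℕ // ∀ j, c j ≤ α i j} =>
          (∏ j, X j ^ c.1 j : MvPolynomial (Fin (m i.succ - m i.castSucc)) K)) ∧
      Submodule.span (invariants ((G i : Set (GL (Fin (m i.succ - m i.castSucc)) K))))
        (Set.range (fun c : {c : Fin (m i.succ - m i.castSucc) → ℕ // ∀ j, c j ≤ α i j} =>
          (∏ j, X j ^ c.1 j : MvPolynomial (Fin (m i.succ - m i.castSucc)) K))) = ⊤) :
    LinearIndependent K
      (fun b : {b : (i : Fin l) → Fin (m i.succ - m i.castSucc) → ℕ //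
          ∀ i j, b i j ≤ (α i j + 1) * Fintype.card K ^ m i.castSucc - 1} =>
        Ideal.Quotient.mk (coinvIdeal (GSet K n m hmono hlast G))
          (∏ i : Fin l, ∏ j, X (emb n m hmono hlast i j) ^ b.1 i j)) ∧
    Submodule.span K
      (Set.range (fun b : {b : (i : Fin l) → Fin (m i.succ - m i.castSucc) → ℕ //
          ∀ i j, b i j ≤ (α i j + 1) * Fintype.card K ^ m i.castSucc - 1} =>
        Ideal.Quotient.mk (coinvIdeal (GSet K n m hmono hlast G))
          (∏ i : Fin l, ∏ j, X (emb n m hmono hlast i j) ^ b.1 i j))) = ⊤ := by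
  have hq : 0 < Fintype.card K := Fintype.card_pos
  have hspan := mem_span_monomials_sup_coinvIdeal hm0 hmono hlast G α fun i => (hbasis i).2
  refine ⟨?_, span_mk_eq_top _ _ hspan⟩
  let E := Equiv.subtypePiEquivPi (p := fun (i : Fin l)
    (c : Fin (m i.succ - m i.castSucc) → ℕ) =>
      ∀ j, c j ≤ (α i j + 1) * Fintype.card K ^ m i.castSucc - 1)
  have hfin (i : Fin l) := finite_subtype_forall_le
    fun j => (α i j + 1) * Fintype.card K ^ m i.castSucc - 1
  have := Fintype.ofFinite {b : (i : Fin l) → Fin (m i.succ - m i.castSucc) → ℕ //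
    ∀ i, ∀ j, b i j ≤ (α i j + 1) * Fintype.card K ^ m i.castSucc - 1}
  refine linearIndependent_mk_of_card_le _ _ (fun b => ⟨_, IsHomogeneous.prod _ _ _ fun i _ =>
    IsHomogeneous.prod _ _ _ fun j _ => isHomogeneous_X_pow _ _⟩) hspan ?_
  refine le_trans ?_ (le_card_GSet hm0 hmono hlast G)
  rw [← Nat.card_eq_fintype_card, Nat.card_congr E, Nat.card_pi]
  refine Finset.prod_le_prod' fun i _ => ?_
  rw [card_subtype_forall_le]
  have hpos (j) : (α i j + 1) * Fintype.card K ^ m i.castSucc - 1 + 1 =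
      (α i j + 1) * Fintype.card K ^ m i.castSucc := Nat.sub_add_cancel
        (Nat.mul_pos (Nat.succ_pos _) (pow_pos hq _))
  simp only [hpos, Finset.prod_mul_distrib, Finset.prod_const, Finset.card_univ, Fintype.card_fin,
    ← pow_mul]
  refine Nat.mul_le_mul_right _ ?_
  have := Fintype.ofFinite (G i)
  have := finite_subtype_forall_le (α i)
  have := Fintype.ofFinite {c : Fin (m i.succ - m i.castSucc) → ℕ // ∀ j, c j ≤ α i j}
  rw [← card_subtype_forall_le, Nat.card_eq_fintype_card, Nat.card_eq_fintype_card]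
  exact card_le_of_linearIndependent_invariants (G i) _ (hbasis i).1
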